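/- Let a : ℕ≥1 → ℂ satisfy a(1) = 1 and fix(a) = a, i.e. Σ_{d∣n} d·a(d) = a(n) for all n ≥ 1. Then for every ε > 0 the series Σ_{n≥1} |a(n)|^{1+ε} converges, i.e. a ∈ ℓ^{1+ε} for all ε > 0. -/

import Mathlib

open Complex Finset

noncomputable def gpp (p k : ℕ) : ℂ := ∏ j ∈ Finset.range k, (1 - (p : ℂ) ^ (j + 1))⁻¹

noncomputable def Ffix : ArithmeticFunction ℂ :=
  ⟨fun n => if n = 0 then 0 else n.factorization.prod gpp, by simp⟩

lemma Ffix_apply {n : ℕ} (hn : n ≠ 0) : Ffix n = n.factorization.prod gpp := by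
  simp [Ffix, hn]

lemma Ffix_mult : Ffix.IsMultiplicative := by
  rw [ArithmeticFunction.IsMultiplicative.iff_ne_zero]
  refine ⟨by simp [Ffix], ?_⟩
  intro m n hm hn hmn
  rw [Ffix_apply hm, Ffix_apply hn, Ffix_apply (mul_ne_zero hm hn),
    Nat.factorization_mul hm hn]
  exact Finsupp.prod_add_index_of_disjoint (by simpa using hmn.disjoint_primeFactors) _

lemma Ffix_pp {p : ℕ} (hp : p.Prime) (k : ℕ) : Ffix (p ^ k) = gpp p k := by
  rw [Ffix_apply (pow_ne_zero _ hp.ne_zero), hp.factorization_pow, Finsupp.prod_single_index]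
  simp [gpp]

lemma one_sub_ne {n : ℕ} (hn : n ≠ 1) : (1 - (n : ℂ)) ≠ 0 := by
  intro h
  exact hn (by exact_mod_cast (sub_eq_zero.mp h).symm)

lemma gpp_sum {p : ℕ} (hp : p.Prime) (k : ℕ) :
    ∑ j ∈ Finset.range (k + 1), (p : ℂ) ^ j * gpp p j = gpp p k := by
  induction k with
  | zero => simp
  | succ k ih =>
    rw [Finset.sum_range_succ, ih]
    have h : (1 - ((p ^ (k + 1) : ℕ) : ℂ)) ≠ 0 :=
      one_sub_ne (by
        have := Nat.one_lt_pow (Nat.succ_ne_zero k) hp.one_lt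
        exact this.ne')
    push_cast at h
    have h2 : gpp p (k + 1) = gpp p k * (1 - (p : ℂ) ^ (k + 1))⁻¹ := by
      exact Finset.prod_range_succ _ _
    rw [h2]
    field_simp
    ring

open ArithmeticFunction in
lemma Ffix_fix : ((ArithmeticFunction.zeta : ArithmeticFunction ℕ) : ArithmeticFunction ℂ) *
    (ArithmeticFunction.pmul
      ((ArithmeticFunction.id : ArithmeticFunction ℕ) : ArithmeticFunction ℂ) Ffix) = Ffix := by
  rw [ArithmeticFunction.IsMultiplicative.eq_iff_eq_on_prime_powers _ _ _ Ffix_mult]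
  · intro p k hp
    rw [ArithmeticFunction.coe_zeta_mul_apply, Nat.sum_divisors_prime_pow hp, Ffix_pp hp,
      ← gpp_sum hp k]
    refine Finset.sum_congr rfl fun j _ => ?_
    simp [Ffix_pp hp]
  · exact (ArithmeticFunction.isMultiplicative_zeta.natCast).mul
      ((ArithmeticFunction.isMultiplicative_id.natCast).pmul Ffix_mult)

lemma Ffix_sum (n : ℕ) : ∑ d ∈ n.divisors, (d : ℂ) * Ffix d = Ffix n := by
  conv_rhs => rw [← Ffix_fix]
  rw [ArithmeticFunction.coe_zeta_mul_apply]
  simp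

lemma eq_Ffix (a : ℕ → ℂ) (ha1 : a 1 = 1)
    (hfix : ∀ n : ℕ, 1 ≤ n → ∑ d ∈ n.divisors, (d : ℂ) * a d = a n) (n : ℕ) :
    1 ≤ n → a n = Ffix n := by
  induction n using Nat.strong_induction_on with
  | _ n ih =>
    intro hn
    rcases eq_or_ne n 1 with rfl | h1
    · rw [ha1, Ffix_mult.map_one]
    have e1 := hfix n hn
    have e2 := Ffix_sum n
    rw [← Nat.cons_self_properDivisors (by omega), Finset.sum_cons] at e1 e2
    have e3 : ∑ d ∈ n.properDivisors, (d : ℂ) * a d = ∑ d ∈ n.properDivisors, (d : ℂ) * Ffix d := by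
      refine Finset.sum_congr rfl fun d hd => ?_
      rw [ih d (Nat.mem_properDivisors.mp hd).2 (Nat.pos_of_mem_properDivisors hd)]
    rw [e3] at e1
    apply mul_left_cancel₀ (one_sub_ne h1)
    linear_combination e2 - e1

lemma gpp_bound {p : ℕ} (hp : 2 ≤ p) (k : ℕ) : (p : ℝ) ^ k * ‖gpp p k‖ ≤ 2 := by
  have hp' : (2 : ℝ) ≤ p := by exact_mod_cast hp
  have step : ∀ k, (p : ℝ) ^ (k + 1) * ‖gpp p (k + 1)‖ =
      ((p : ℝ) ^ k * ‖gpp p k‖) * (p / ((p : ℝ) ^ (k + 1) - 1)) := by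
    intro k
    have h1 : (1 : ℝ) ≤ (p : ℝ) ^ (k + 1) := one_le_pow₀ (by linarith)
    have h2 : gpp p (k + 1) = gpp p k * (1 - (p : ℂ) ^ (k + 1))⁻¹ := by
      exact Finset.prod_range_succ _ _
    have h3 : ‖(1 - (p : ℂ) ^ (k + 1))‖ = (p : ℝ) ^ (k + 1) - 1 := by
      have : (1 - (p : ℂ) ^ (k + 1)) = ((1 - (p : ℝ) ^ (k + 1) : ℝ) : ℂ) := by push_cast; rfl
      rw [this, Complex.norm_real, Real.norm_eq_abs, abs_of_nonpos (by linarith)]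
      ring
    rw [h2, norm_mul, norm_inv, h3]
    ring
  induction k with
  | zero => simp [gpp]
  | succ k ih =>
    rw [step]
    rcases k with _ | k
    · simp only [gpp, Finset.range_zero, Finset.prod_empty, pow_zero, norm_one, zero_add, pow_one]
      rw [one_mul, one_mul, div_le_iff₀ (by linarith)]
      linarith
    · have h1 : (p : ℝ) ^ 2 ≤ (p : ℝ) ^ (k + 1 + 1) :=
        pow_le_pow_right₀ (by linarith) (by omega)
      have h4 : (p : ℝ) / ((p : ℝ) ^ (k + 1 + 1) - 1) ≤ 1 := by
        rw [div_le_one (by nlinarith)]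
        nlinarith
      calc _ ≤ (p : ℝ) ^ (k + 1) * ‖gpp p (k + 1)‖ * 1 := by gcongr
        _ ≤ 2 := by linarith

lemma Ffix_bound {n : ℕ} (hn : n ≠ 0) : (n : ℝ) * ‖Ffix n‖ ≤ ∏ _p ∈ n.primeFactors, (2 : ℝ) := by
  have h : (n : ℝ) = ∏ p ∈ n.primeFactors, (p : ℝ) ^ (n.factorization p) := by
    conv_lhs => rw [← Nat.prod_factorization_pow_eq_self hn]
    simp [Finsupp.prod]
  rw [Ffix_apply hn, Finsupp.prod, norm_prod, Nat.support_factorization, h,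
    ← Finset.prod_mul_distrib]
  refine Finset.prod_le_prod (fun _ _ => by positivity) fun p hp => ?_
  exact gpp_bound (Nat.prime_of_mem_primeFactors hp).two_le _

lemma two_bound {δ : ℝ} (hδ : 0 < δ) : ∃ C : ℝ, 0 < C ∧ ∀ n : ℕ, n ≠ 0 →
    ∏ _p ∈ n.primeFactors, (2 : ℝ) ≤ C * (n : ℝ) ^ δ := by
  obtain ⟨P, hP⟩ := Filter.eventually_atTop.mp
    (((tendsto_rpow_atTop hδ).comp tendsto_natCast_atTop_atTop).eventually_ge_atTop (2 : ℝ))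
  refine ⟨2 ^ P, by positivity, fun n hn => ?_⟩
  calc ∏ _p ∈ n.primeFactors, (2 : ℝ)
      ≤ ∏ p ∈ n.primeFactors, ((if p < P then (2 : ℝ) else 1) * (p : ℝ) ^ δ) := by
        refine Finset.prod_le_prod (fun _ _ => by norm_num) fun p hp => ?_
        have h1 : (1 : ℝ) ≤ p := by
          exact_mod_cast (Nat.prime_of_mem_primeFactors hp).one_lt.le
        split_ifs with h
        · have := Real.one_le_rpow h1 hδ.le
          linarith
        · rw [one_mul]
          exact hP p (not_lt.mp h)
    _ = (∏ p ∈ n.primeFactors, (if p < P then (2 : ℝ) else 1)) *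
          ((∏ p ∈ n.primeFactors, p : ℕ) : ℝ) ^ δ := by
        rw [Finset.prod_mul_distrib]
        push_cast
        rw [Real.finsetProd_rpow _ _ (fun _ _ => by positivity)]
    _ ≤ 2 ^ P * (n : ℝ) ^ δ := by
        gcongr
        · rw [← Finset.prod_filter, Finset.prod_const]
          refine pow_le_pow_right₀ (by norm_num) ?_
          calc _ ≤ (Finset.range P).card := Finset.card_le_card (by
                  intro x hx
                  simpa using (Finset.mem_filter.mp hx).2)
            _ = P := Finset.card_range P
        · exact Nat.le_of_dvd (Nat.pos_of_ne_zero hn) (Nat.prod_primeFactors_dvd n)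

theorem stmt4 (a : ℕ → ℂ) (ha1 : a 1 = 1)
    (hfix : ∀ n : ℕ, 1 ≤ n → ∑ d ∈ n.divisors, (d : ℂ) * a d = a n) :
    ∀ ε : ℝ, 0 < ε → Summable (fun n : ℕ+ => ‖a n‖ ^ ((1 : ℝ) + ε)) := by
  intro ε hε
  obtain ⟨C, hC, hb⟩ := two_bound (δ := ε / (2 * (1 + ε))) (by positivity)
  have hs : Summable (fun n : ℕ => C ^ (1 + ε) * (n : ℝ) ^ (-(1 + ε / 2))) :=
    (Real.summable_nat_rpow.mpr (by linarith)).mul_left _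
  have hs' := hs.comp_injective PNat.coe_injective
  refine Summable.of_nonneg_of_le (fun _ => by positivity) (fun n => ?_) hs'
  have hn : (0 : ℝ) < (n : ℕ) := by exact_mod_cast n.pos
  have h1 : ‖a n‖ ≤ C * ((n : ℕ) : ℝ) ^ (ε / (2 * (1 + ε)) - 1) := by
    rw [eq_Ffix a ha1 hfix n n.pos, Real.rpow_sub_one hn.ne', ← mul_div_assoc, le_div_iff₀ hn,
      mul_comm]
    exact (Ffix_bound n.ne_zero).trans (hb n n.ne_zero)
  calc ‖a n‖ ^ (1 + ε) ≤ (C * ((n : ℕ) : ℝ) ^ (ε / (2 * (1 + ε)) - 1)) ^ (1 + ε) := by gcongr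
    _ = _ := by
      rw [Real.mul_rpow hC.le (by positivity), ← Real.rpow_mul hn.le]
      simp only [Function.comp]
      congr 2
      field_simp
      ring
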